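/- Let M ≥ 0 be an integer, R > 0, and let f_M be the 2^M-pole field centred at X₊ = (0,0,R/2) with complex coefficients A_{Mm} (−M ≤ m ≤ M). Then for every x = (x₁,x₂,x₃) ∈ ℝ³ with x₃ < R/2, the function k ↦ e^{−‖k‖(R/2 − x₃)} ‖k‖^{M−1} Θ(ψ(k)) e^{i(k₁x₁+k₂x₂)} is integrable on ℝ² and f_M(x) = (1/(2π)) ∫_{ℝ²} e^{−‖k‖(R/2 − x₃)} ‖k‖^{M−1} Θ(ψ(k)) e^{i(k₁x₁+k₂x₂)} dk, where Θ(ψ) = Σ_{m=−M}^{M} (i/2)^{|m|} A_{Mm} e^{imψ} and, for k ≠ 0, ψ(k) ∈ [0,2π) is the polar angle of k, i.e. k₁ + ik₂ = ‖k‖e^{iψ(k)}. -/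

import Mathlib

open MeasureTheory Real Finset

noncomputable section

/-- `ℝ³` with the Euclidean norm. -/
abbrev E3 : Type := EuclideanSpace ℝ (Fin 3)

/-- `ℝ²` with the Euclidean norm. -/
abbrev E2 : Type := EuclideanSpace ℝ (Fin 2)

/-- Points of `ℝ³` from three coordinates. -/
def mk3 (a b c : ℝ) : E3 := (WithLp.equiv 2 (Fin 3 → ℝ)).symm ![a, b, c]

/-- Partial derivative `∂ᵢ` of a complex-valued function on `ℝ³`. -/
def pd (i : Fin 3) (f : E3 → ℂ) : E3 → ℂ :=
  fun x => fderiv ℝ f x (EuclideanSpace.single i 1)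

/-- The complex derivative `∂ = (1/2)(∂₁ - i∂₂)`. -/
def cd (f : E3 → ℂ) : E3 → ℂ :=
  fun x => (1 / 2 : ℂ) * (pd 0 f x - Complex.I * pd 1 f x)

/-- The complex derivative `∂̄ = (1/2)(∂₁ + i∂₂)`. -/
def cdbar (f : E3 → ℂ) : E3 → ℂ :=
  fun x => (1 / 2 : ℂ) * (pd 0 f x + Complex.I * pd 1 f x)

/-- The Coulomb potential `x ↦ 1/‖x - c‖` centred at `c`. -/
def coul (c : E3) : E3 → ℂ := fun x => ((‖x - c‖ : ℝ) : ℂ)⁻¹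

/-- The `2^M`-pole field centred at `c` with coefficients `A m`, `-M ≤ m ≤ M`. -/
def pole (M : ℕ) (A : ℤ → ℂ) (c : E3) : E3 → ℂ := fun x =>
  ∑ m ∈ Finset.Icc (-(M : ℤ)) (M : ℤ), A m *
    (if 1 ≤ m then (pd 2)^[((M : ℤ) - m).toNat] (cdbar^[m.toNat] (coul c)) x
     else (pd 2)^[((M : ℤ) + m).toNat] (cd^[(-m).toNat] (coul c)) x)

/-- The polar angle `ψ(k) ∈ [0, 2π)` of `k ∈ ℝ² \ {0}`, so that
`k₁ + ik₂ = ‖k‖ e^{iψ(k)}`. -/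
def polarAngle (k : E2) : ℝ :=
  if Complex.arg ((k 0 : ℂ) + (k 1 : ℂ) * Complex.I) < 0 then
    Complex.arg ((k 0 : ℂ) + (k 1 : ℂ) * Complex.I) + 2 * π
  else Complex.arg ((k 0 : ℂ) + (k 1 : ℂ) * Complex.I)

/-- `Θ(ψ) = Σ_{m=-M}^{M} (i/2)^{|m|} A_{Mm} e^{imψ}`. -/
def Theta (M : ℕ) (A : ℤ → ℂ) (ψ : ℝ) : ℂ :=
  ∑ m ∈ Finset.Icc (-(M : ℤ)) (M : ℤ),
    (Complex.I / 2) ^ m.natAbs * A m * Complex.exp (Complex.I * (m : ℂ) * (ψ : ℂ))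

lemma intervalIntegral_inv_sub_I_mul (a b d : ℝ) (hd : 0 < d) :
    ∫ θ in (0 : ℝ)..2 * π,
      ((d : ℂ) - Complex.I * ((a * Real.cos θ + b * Real.sin θ : ℝ) : ℂ))⁻¹
      = 2 * π / (√(a ^ 2 + b ^ 2 + d ^ 2) : ℝ) := by
  set s : ℝ := √(a ^ 2 + b ^ 2 + d ^ 2) with hs
  have hs2 : s ^ 2 = a ^ 2 + b ^ 2 + d ^ 2 := Real.sq_sqrt (by positivity)
  have hs0 : 0 < s := Real.sqrt_pos.2 (by positivity)
  set α : ℂ := (a : ℂ) + b * Complex.I with hα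
  set β : ℂ := (a : ℂ) - b * Complex.I with hβ
  have hnα : ‖α‖ ^ 2 = a ^ 2 + b ^ 2 := by
    rw [← Complex.normSq_eq_norm_sq, hα, Complex.normSq_add_mul_I]
  have hnβ : ‖β‖ ^ 2 = a ^ 2 + b ^ 2 := by
    have : β = (a : ℂ) + ((-b : ℝ) : ℂ) * Complex.I := by rw [hβ]; push_cast; ring
    rw [← Complex.normSq_eq_norm_sq, this, Complex.normSq_add_mul_I]; ring
  have hsd : (0 : ℝ) < s + d := by positivity
  have hα1 : ‖α‖ < s + d := lt_of_pow_lt_pow_left₀ 2 hsd.le (by nlinarith)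
  have hβ1 : ‖β‖ < s + d := lt_of_pow_lt_pow_left₀ 2 hsd.le (by nlinarith)
  have hsdC : ((s : ℂ) + d) ≠ 0 := by exact_mod_cast hsd.ne'
  have hnsd : ‖(s : ℂ) + d‖ = s + d := by
    rw [← Complex.ofReal_add, Complex.norm_real, Real.norm_of_nonneg hsd.le]
  have hsC : (s : ℂ) ≠ 0 := by exact_mod_cast hs0.ne'
  have hs2C : (s : ℂ) ^ 2 = a ^ 2 + b ^ 2 + d ^ 2 := by exact_mod_cast hs2
  set q : ℂ := Complex.I * α / (s + d) with hq
  have hq1 : ‖q‖ < 1 := by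
    rw [hq, norm_div, norm_mul, Complex.norm_I, one_mul, hnsd, div_lt_one hsd]
    exact hα1
  have hI : Complex.I ^ 2 = -1 := Complex.I_sq
  have hαβ : α * β = a ^ 2 + b ^ 2 := by rw [hα, hβ]; linear_combination -(b : ℂ) ^ 2 * hI
  have hden : ∀ z : ℂ, ‖z‖ ≤ 1 → ((s : ℂ) + d) - Complex.I * β * z ≠ 0 := by
    intro z hz h
    have h1 : (s : ℂ) + d = Complex.I * β * z := sub_eq_zero.1 h
    have h2 := congrArg norm h1
    rw [hnsd, norm_mul, norm_mul, Complex.norm_I, one_mul] at h2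
    nlinarith [norm_nonneg β]
  have key := DiffContOnCl.circleIntegral_sub_inv_smul (R := 1) (c := (0 : ℂ)) (w := q)
    (f := fun z => (((s : ℂ) + d) - Complex.I * β * z)⁻¹)
    (DifferentiableOn.diffContOnCl (by
      rw [closure_ball _ one_ne_zero]
      intro z hz
      have hz' : ‖z‖ ≤ 1 := by simpa using hz
      have hd1 : DifferentiableAt ℂ (fun z : ℂ => ((s : ℂ) + d) - Complex.I * β * z) z := by
        fun_prop
      exact (hd1.inv (hden z hz')).differentiableWithinAt))
    (by simpa using hq1)
  have hval : ((s : ℂ) + d) - Complex.I * β * q = 2 * s := by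
    rw [hq]; field_simp
    linear_combination (-(α * β)) * hI + hαβ - hs2C
  have hcongr : ∀ θ : ℝ,
      ((d : ℂ) - Complex.I * ((a * Real.cos θ + b * Real.sin θ : ℝ) : ℂ))⁻¹
        = (-2 * Complex.I) * (deriv (circleMap 0 1) θ • ((circleMap 0 1 θ - q)⁻¹ •
            (((s : ℂ) + d) - Complex.I * β * circleMap 0 1 θ)⁻¹)) := by
    intro θ
    set z := circleMap 0 1 θ with hz
    have hz1 : ‖z‖ = 1 := by simp [hz]
    have hzc : z = Complex.cos θ + Complex.sin θ * Complex.I := by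
      rw [hz, circleMap]; simp [Complex.exp_mul_I]
    have hcs : Complex.sin θ ^ 2 + Complex.cos θ ^ 2 = 1 := Complex.sin_sq_add_cos_sq _
    have hd0 : ((d : ℂ) - Complex.I * ((a * Real.cos θ + b * Real.sin θ : ℝ) : ℂ)) ≠ 0 := by
      intro h
      have := congrArg Complex.re h
      simp at this
      exact hd.ne' (by simpa using this)
    have hmul : (z - q) * (((s : ℂ) + d) - Complex.I * β * z)
        = 2 * z * ((d : ℂ) - Complex.I * ((a * Real.cos θ + b * Real.sin θ : ℝ) : ℂ)) := by
      have hqs : q * (s + d) = Complex.I * α := by rw [hq]; field_simp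
      have hqb : q * (Complex.I * β) = d - s := by linear_combination -hval
      have e : (z - q) * (((s : ℂ) + d) - Complex.I * β * z)
          = 2 * d * z - Complex.I * (β * z ^ 2 + α) := by
        linear_combination -hqs + z * hqb
      have e2 : β * z ^ 2 + α = 2 * z * (a * Complex.cos θ + b * Complex.sin θ) := by
        rw [hzc, hα, hβ]
        linear_combination (-2 * b * Complex.sin θ *
          (Complex.cos θ + Complex.sin θ * Complex.I)
          + (a + b * Complex.I) * Complex.sin θ ^ 2) * hI - (a + b * Complex.I) * hcs
      rw [e, e2]; push_cast; ring
    rw [deriv_circleMap, ← hz, smul_eq_mul, smul_eq_mul, ← mul_inv, hmul]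
    have hz0 : z ≠ 0 := by intro h; simp [h] at hz1
    field_simp
    linear_combination hI
  simp_rw [hcongr]
  rw [intervalIntegral.integral_const_mul]
  rw [circleIntegral] at key
  rw [key, hval, smul_eq_mul]
  field_simp
  linear_combination -hI


lemma integrable_exp_neg_mul_norm_mul_inv_norm {δ : ℝ} (hδ : 0 < δ) :
    Integrable (fun k : E2 => Real.exp (-(δ * ‖k‖)) * ‖k‖⁻¹) := by
  refine (integrable_fun_norm_addHaar volume (f := fun r : ℝ => Real.exp (-(δ * r)) * r⁻¹)).2 ?_
  refine (integrableOn_congr_fun ?_ measurableSet_Ioi).2 (exp_neg_integrableOn_Ioi 0 hδ)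
  intro r hr
  have hr0 : r ≠ 0 := ne_of_gt hr
  simp
  field_simp

lemma integral_exp_mul_inv_norm (a b d : ℝ) (hd : 0 < d) :
    ∫ k : E2, Complex.exp (-(‖k‖ * d) + Complex.I * (k 0 * a + k 1 * b)) * (‖k‖ : ℂ)⁻¹
      = 2 * π / (√(a ^ 2 + b ^ 2 + d ^ 2) : ℝ) := by
  set g : ℝ → ℂ := fun θ => -(d : ℂ) + Complex.I * ((a * Real.cos θ + b * Real.sin θ : ℝ) : ℂ)
    with hg
  have hgre : ∀ θ, (g θ).re = -d := by intro θ; simp [hg]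
  have hgc : Continuous g := by rw [hg]; fun_prop
  rw [← (Complex.orthonormalBasisOneI.repr.measurePreserving).integral_comp
      Complex.orthonormalBasisOneI.repr.toHomeomorph.measurableEmbedding,
    ← Complex.integral_comp_polarCoord_symm, polarCoord_target]
  have hpt : ∀ p ∈ Set.Ioi (0 : ℝ) ×ˢ Set.Ioo (-π) π,
      p.1 • (Complex.exp (-(‖Complex.orthonormalBasisOneI.repr (Complex.polarCoord.symm p)‖ * d)
          + Complex.I * ((Complex.orthonormalBasisOneI.repr (Complex.polarCoord.symm p)) 0 * a
            + (Complex.orthonormalBasisOneI.repr (Complex.polarCoord.symm p)) 1 * b))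
        * (‖Complex.orthonormalBasisOneI.repr (Complex.polarCoord.symm p)‖ : ℂ)⁻¹)
      = Complex.exp (g p.2 * p.1) := by
    rintro ⟨r, θ⟩ ⟨hr, -⟩
    have hr0 : (0 : ℝ) < r := hr
    have hrC : (r : ℂ) ≠ 0 := by exact_mod_cast hr0.ne'
    rw [LinearIsometryEquiv.norm_map, Complex.norm_polarCoord_symm, abs_of_pos hr0,
      Complex.orthonormalBasisOneI_repr_apply, Complex.polarCoord_symm_apply, Complex.real_smul]
    have e : ∀ z : ℂ, (r : ℂ) * (z * (r : ℂ)⁻¹) = z := fun z => by field_simp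
    rw [e]
    congr 1
    simp [hg, -Complex.ofReal_cos, -Complex.ofReal_sin]
    ring
  rw [setIntegral_congr_fun (measurableSet_Ioi.prod measurableSet_Ioo) hpt]
  have hint : Integrable (fun p : ℝ × ℝ => Complex.exp (g p.2 * p.1))
      ((volume.restrict (Set.Ioi (0 : ℝ))).prod (volume.restrict (Set.Ioo (-π) π))) := by
    have h1 : Integrable (fun p : ℝ × ℝ => Real.exp (-d * p.1) * (1 : ℝ))
        ((volume.restrict (Set.Ioi (0 : ℝ))).prod (volume.restrict (Set.Ioo (-π) π))) :=
      Integrable.mul_prod (g := fun _ : ℝ => (1 : ℝ)) (exp_neg_integrableOn_Ioi 0 hd)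
        (integrable_const _)
    refine h1.mono' (Continuous.aestronglyMeasurable (by fun_prop)) (ae_of_all _ fun p => ?_)
    rw [Complex.norm_exp, Complex.re_mul_ofReal, hgre, mul_one]
  rw [Measure.volume_eq_prod, ← Measure.prod_restrict, integral_prod_symm _ hint]
  have hr : ∀ θ : ℝ, ∫ r in Set.Ioi (0 : ℝ), Complex.exp (g θ * r)
      = ((d : ℂ) - Complex.I * ((a * Real.cos θ + b * Real.sin θ : ℝ) : ℂ))⁻¹ := by
    intro θ
    rw [integral_exp_mul_complex_Ioi (by rw [hgre]; linarith)]
    rw [Complex.ofReal_zero, mul_zero, Complex.exp_zero, neg_div, one_div, ← inv_neg]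
    congr 1
    simp only [hg]; ring
  simp only [hr]
  rw [← integral_Ioc_eq_integral_Ioo, ← intervalIntegral.integral_of_le (by linarith [pi_pos]),
    ← intervalIntegral_inv_sub_I_mul a b d hd]
  have hper : Function.Periodic (fun θ : ℝ =>
      ((d : ℂ) - Complex.I * ((a * Real.cos θ + b * Real.sin θ : ℝ) : ℂ))⁻¹) (2 * π) := by
    intro θ; simp only [Real.cos_add_two_pi, Real.sin_add_two_pi]
  have := hper.intervalIntegral_add_eq (-π) 0
  rw [show -π + 2 * π = π by ring, zero_add] at this
  exact this

/-- The `i`-th coordinate of `ℝ³` as a complex-valued real-linear map. -/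
def coordC (i : Fin 3) : E3 →L[ℝ] ℂ := Complex.ofRealCLM.comp (EuclideanSpace.proj i)

@[simp] lemma coordC_apply (i : Fin 3) (x : E3) : coordC i x = (x i : ℂ) := rfl

/-- The complex phase `x ↦ ‖k‖ x₃ + i (k₁ x₁ + k₂ x₂)`, linear in `x`. -/
def phase (k : E2) : E3 →L[ℝ] ℂ :=
  (‖k‖ : ℂ) • coordC 2 + (Complex.I * (k 0 : ℂ)) • coordC 0 + (Complex.I * (k 1 : ℂ)) • coordC 1

lemma phase_apply (k : E2) (x : E3) :
    phase k x = ‖k‖ * x 2 + Complex.I * k 0 * x 0 + Complex.I * k 1 * x 1 := by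
  simp [phase]

lemma phase_re (k : E2) (x : E3) : (phase k x).re = ‖k‖ * x 2 := by
  simp [phase_apply]

@[fun_prop]
lemma continuous_phase : Continuous phase := by
  unfold phase; fun_prop

lemma exists_norm_phase_le : ∃ C : ℝ, 0 ≤ C ∧ ∀ k : E2, ‖phase k‖ ≤ C * ‖k‖ := by
  refine ⟨‖coordC 2‖ + ‖coordC 0‖ + ‖coordC 1‖, by positivity, fun k => ?_⟩
  have h0 : ‖k 0‖ ≤ ‖k‖ := PiLp.norm_apply_le k 0
  have h1 : ‖k 1‖ ≤ ‖k‖ := PiLp.norm_apply_le k 1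
  refine (norm_add₃_le).trans ?_
  simp only [norm_smul, norm_mul, Complex.norm_I, one_mul, Complex.norm_real, norm_norm]
  nlinarith [norm_nonneg (coordC 0), norm_nonneg (coordC 1)]

/-- Weights on `ℝ²` that are integrable against `e^{-δ‖k‖}` for every `δ > 0`. -/
def Admissible (w : E2 → ℂ) : Prop :=
  AEStronglyMeasurable w ∧ ∀ δ : ℝ, 0 < δ → Integrable (fun k => Real.exp (-(δ * ‖k‖)) * ‖w k‖)

lemma Admissible.of_norm_le {w v : E2 → ℂ} (hw : Admissible w) (hv : AEStronglyMeasurable v)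
    {C : ℝ} (h : ∀ k, ‖v k‖ ≤ C * (‖k‖ * ‖w k‖)) : Admissible v := by
  refine ⟨hv, fun δ hδ => ?_⟩
  refine ((hw.2 (δ / 2) (by positivity)).const_mul (|C| * (2 / δ))).mono'
    (AEStronglyMeasurable.mul (Continuous.aestronglyMeasurable (by fun_prop)) hv.norm)
    (ae_of_all _ fun k => ?_)
  rw [Real.norm_of_nonneg (by positivity)]
  have h1 : ‖k‖ ≤ 2 / δ * Real.exp (δ / 2 * ‖k‖) := by
    have := Real.add_one_le_exp (δ / 2 * ‖k‖)
    rw [div_mul_eq_mul_div, le_div_iff₀ hδ]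
    nlinarith
  have h2 : Real.exp (-(δ * ‖k‖)) = Real.exp (-(δ / 2 * ‖k‖)) * Real.exp (-(δ / 2 * ‖k‖)) := by
    rw [← Real.exp_add]; congr 1; ring
  have h3 : Real.exp (-(δ / 2 * ‖k‖)) * Real.exp (δ / 2 * ‖k‖) = 1 := by
    rw [← Real.exp_add]; simp
  have h4 : Real.exp (-(δ / 2 * ‖k‖)) * ‖k‖ ≤ 2 / δ := by
    calc _ ≤ Real.exp (-(δ / 2 * ‖k‖)) * (2 / δ * Real.exp (δ / 2 * ‖k‖)) := by gcongr
      _ = 2 / δ := by rw [mul_left_comm, h3, mul_one]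
  calc Real.exp (-(δ * ‖k‖)) * ‖v k‖ ≤ Real.exp (-(δ * ‖k‖)) * (|C| * (‖k‖ * ‖w k‖)) := by
        gcongr
        exact (h k).trans (by gcongr; exact le_abs_self C)
    _ = |C| * (Real.exp (-(δ / 2 * ‖k‖)) * ‖k‖) * (Real.exp (-(δ / 2 * ‖k‖)) * ‖w k‖) := by
        rw [h2]; ring
    _ ≤ |C| * (2 / δ) * (Real.exp (-(δ / 2 * ‖k‖)) * ‖w k‖) := by gcongr

lemma Admissible.phase_mul {w : E2 → ℂ} (hw : Admissible w) (v : E3) :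
    Admissible (fun k => phase k v * w k) := by
  obtain ⟨C, hC, h⟩ := exists_norm_phase_le
  refine hw.of_norm_le (C := C * ‖v‖) ?_ fun k => ?_
  · exact AEStronglyMeasurable.mul (Continuous.aestronglyMeasurable (by fun_prop)) hw.1
  · rw [norm_mul]
    calc ‖phase k v‖ * ‖w k‖ ≤ (C * ‖k‖ * ‖v‖) * ‖w k‖ := by
          gcongr
          exact ((phase k).le_opNorm v).trans (by gcongr; exact h k)
      _ = _ := by ring

lemma Admissible.add {w v : E2 → ℂ} (hw : Admissible w) (hv : Admissible v) :
    Admissible (fun k => w k + v k) := by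
  refine ⟨hw.1.add hv.1, fun δ hδ => ((hw.2 δ hδ).add (hv.2 δ hδ)).mono'
    (AEStronglyMeasurable.mul (Continuous.aestronglyMeasurable (by fun_prop)) (hw.1.add hv.1).norm)
    (ae_of_all _ fun k => ?_)⟩
  rw [Real.norm_of_nonneg (by positivity)]
  simp only [Pi.add_apply, ← mul_add]
  gcongr
  exact norm_add_le _ _

lemma Admissible.const_mul {w : E2 → ℂ} (hw : Admissible w) (a : ℂ) :
    Admissible (fun k => a * w k) := by
  refine ⟨hw.1.const_mul a, fun δ hδ => ?_⟩
  refine ((hw.2 δ hδ).const_mul ‖a‖).congr (ae_of_all _ fun k => ?_)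
  simp only [norm_mul]; ring

lemma norm_exp_phase_sub (c : ℝ) (k : E2) (x : E3) :
    ‖Complex.exp (phase k x - ‖k‖ * c)‖ = Real.exp (-((c - x 2) * ‖k‖)) := by
  rw [Complex.norm_exp, Complex.sub_re, phase_re, Complex.re_ofReal_mul, Complex.ofReal_re]
  congr 1; ring

lemma Admissible.integrable {w : E2 → ℂ} (hw : Admissible w) {c : ℝ} {x : E3} (hx : x 2 < c) :
    Integrable (fun k => Complex.exp (phase k x - ‖k‖ * c) * w k) := by
  refine (hw.2 (c - x 2) (sub_pos.2 hx)).mono'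
    (AEStronglyMeasurable.mul (Continuous.aestronglyMeasurable (by fun_prop)) hw.1)
    (ae_of_all _ fun k => ?_)
  rw [norm_mul, norm_exp_phase_sub]

/-- The Fourier–Laplace integral of a weight `w`, at height `c`. -/
def fourierLaplace (c : ℝ) (w : E2 → ℂ) (x : E3) : ℂ :=
  ∫ k : E2, Complex.exp (phase k x - ‖k‖ * c) * w k

lemma isOpen_halfSpace (c : ℝ) : IsOpen {x : E3 | x 2 < c} :=
  isOpen_lt (by fun_prop) continuous_const

lemma hasFDerivAt_fourierLaplace {w : E2 → ℂ} (hw : Admissible w) {c : ℝ} {x : E3}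
    (hx : x 2 < c) :
    HasFDerivAt (fourierLaplace c w)
      (∫ k : E2, (Complex.exp (phase k x - ‖k‖ * c) * w k) • phase k) x := by
  obtain ⟨C, hC, hle⟩ := exists_norm_phase_le
  obtain ⟨c', hxc, hcc⟩ := exists_between hx
  have hw' : Admissible (fun k => (C * ‖k‖ : ℂ) * w k) :=
    hw.of_norm_le (C := C)
      (AEStronglyMeasurable.mul (Continuous.aestronglyMeasurable (by fun_prop)) hw.1)
      fun k => by simp [abs_of_nonneg hC, mul_assoc]
  refine hasFDerivAt_integral_of_dominated_of_fderiv_le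
    (F := fun x k => Complex.exp (phase k x - ‖k‖ * c) * w k)
    (F' := fun x k => (Complex.exp (phase k x - ‖k‖ * c) * w k) • phase k)
    (bound := fun k => Real.exp (-((c - c') * ‖k‖)) * ‖(C * ‖k‖ : ℂ) * w k‖)
    (s := {x : E3 | x 2 < c'}) ((isOpen_halfSpace c').mem_nhds hxc) ?_ (hw.integrable hx) ?_ ?_
    (hw'.2 _ (sub_pos.2 hcc)) ?_
  · exact Filter.Eventually.of_forall fun y =>
      AEStronglyMeasurable.mul (Continuous.aestronglyMeasurable (by fun_prop)) hw.1
  · exact AEStronglyMeasurable.smul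
      (AEStronglyMeasurable.mul (Continuous.aestronglyMeasurable (by fun_prop)) hw.1)
      continuous_phase.aestronglyMeasurable
  · refine ae_of_all _ fun k y hy => ?_
    have hy' : y 2 < c' := hy
    rw [norm_smul, norm_mul, norm_exp_phase_sub]
    have e : ‖(C * ‖k‖ : ℂ) * w k‖ = ‖w k‖ * (C * ‖k‖) := by
      simp [abs_of_nonneg hC, mul_comm]
    rw [e, ← mul_assoc]
    gcongr
    exact hle k
  · refine ae_of_all _ fun k y _ => ?_
    have h := (((phase k).hasFDerivAt (x := y)).sub_const (‖k‖ * c : ℂ)).cexp.mul_const (w k)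
    rw [smul_smul, mul_comm (w k)] at h
    exact h

/-- `f` is given on `{x₃ < c}` by the Fourier–Laplace integral of the weight `w`. -/
def Represents (c : ℝ) (f : E3 → ℂ) (w : E2 → ℂ) : Prop :=
  Admissible w ∧ ∀ x : E3, x 2 < c → f x = fourierLaplace c w x

lemma Represents.pd {c : ℝ} {f : E3 → ℂ} {w : E2 → ℂ} (h : Represents c f w) (i : Fin 3) :
    Represents c (pd i f) (fun k => phase k (EuclideanSpace.single i 1) * w k) := by
  obtain ⟨C, hC, hle⟩ := exists_norm_phase_le
  refine ⟨h.1.phase_mul _, fun x hx => ?_⟩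
  have he : f =ᶠ[nhds x] fourierLaplace c w := by
    filter_upwards [(isOpen_halfSpace c).mem_nhds hx] with y hy using h.2 y hy
  have hd := hasFDerivAt_fourierLaplace h.1 hx
  have hint : Integrable (fun k => (Complex.exp (phase k x - ‖k‖ * c) * w k) • phase k) := by
    have hw' : Admissible (fun k => (C * ‖k‖ : ℂ) * w k) :=
      h.1.of_norm_le (C := C)
        (AEStronglyMeasurable.mul (Continuous.aestronglyMeasurable (by fun_prop)) h.1.1)
        fun k => by simp [abs_of_nonneg hC, mul_assoc]
    refine (hw'.integrable hx).norm.mono' (AEStronglyMeasurable.smul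
      (AEStronglyMeasurable.mul (Continuous.aestronglyMeasurable (by fun_prop)) h.1.1)
      continuous_phase.aestronglyMeasurable) (ae_of_all _ fun k => ?_)
    rw [norm_smul, norm_mul, norm_mul, norm_mul, norm_mul, mul_assoc]
    rw [mul_comm ‖w k‖]
    gcongr
    simpa [abs_of_nonneg hC] using hle k
  rw [_root_.pd, he.fderiv_eq, hd.fderiv, ContinuousLinearMap.integral_apply hint]
  refine integral_congr_ae (ae_of_all _ fun k => ?_)
  simp only [smul_apply, smul_eq_mul]
  ring

lemma Represents.add {c : ℝ} {f g : E3 → ℂ} {w v : E2 → ℂ} (hf : Represents c f w)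
    (hg : Represents c g v) : Represents c (fun x => f x + g x) (fun k => w k + v k) := by
  refine ⟨hf.1.add hg.1, fun x hx => ?_⟩
  simp only [hf.2 x hx, hg.2 x hx, fourierLaplace, mul_add]
  rw [integral_add (hf.1.integrable hx) (hg.1.integrable hx)]

lemma Represents.const_mul {c : ℝ} {f : E3 → ℂ} {w : E2 → ℂ} (hf : Represents c f w) (a : ℂ) :
    Represents c (fun x => a * f x) (fun k => a * w k) := by
  refine ⟨hf.1.const_mul a, fun x hx => ?_⟩
  simp only [hf.2 x hx, fourierLaplace, mul_left_comm _ a]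
  rw [integral_const_mul]

lemma Represents.congr {c : ℝ} {f g : E3 → ℂ} {w v : E2 → ℂ} (hf : Represents c f w)
    (hfg : ∀ x, g x = f x) (hwv : ∀ k, v k = w k) : Represents c g v := by
  obtain rfl : g = f := funext hfg
  obtain rfl : v = w := funext hwv
  exact hf

lemma Represents.sum {ι : Type*} (s : Finset ι) {c : ℝ} {f : ι → E3 → ℂ} {w : ι → E2 → ℂ}
    (h : ∀ i ∈ s, Represents c (f i) (w i)) :
    Represents c (fun x => ∑ i ∈ s, f i x) (fun k => ∑ i ∈ s, w i k) := by
  classical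
  induction s using Finset.induction_on with
  | empty =>
    refine ⟨⟨by simpa using aestronglyMeasurable_const, fun δ _ => by simp⟩, fun x _ => ?_⟩
    simp [fourierLaplace]
  | insert i s hi ih =>
    refine ((h i (mem_insert_self i s)).add
      (ih fun j hj => h j (mem_insert_of_mem hj))).congr ?_ ?_
    · intro x; rw [sum_insert hi]
    · intro k; rw [sum_insert hi]

lemma Represents.iterate {c : ℝ} {D : (E3 → ℂ) → E3 → ℂ} {μ : E2 → ℂ}
    (hD : ∀ f w, Represents c f w → Represents c (D f) (fun k => μ k * w k))
    {f : E3 → ℂ} {w : E2 → ℂ} (h : Represents c f w) (n : ℕ) :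
    Represents c (D^[n] f) (fun k => μ k ^ n * w k) := by
  induction n with
  | zero => simpa using h
  | succ n ih =>
    rw [Function.iterate_succ_apply']
    exact (hD _ _ ih).congr (fun _ => rfl) fun k => by ring

lemma Represents.pd_two {c : ℝ} {f : E3 → ℂ} {w : E2 → ℂ} (h : Represents c f w) :
    Represents c (_root_.pd 2 f) (fun k => (‖k‖ : ℂ) * w k) :=
  (h.pd 2).congr (fun _ => rfl) fun k => by simp [phase_apply]

lemma Represents.cd {c : ℝ} {f : E3 → ℂ} {w : E2 → ℂ} (h : Represents c f w) :
    Represents c (cd f) (fun k => (Complex.I / 2 * (k 0 - k 1 * Complex.I)) * w k) :=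
  (((h.pd 0).add ((h.pd 1).const_mul (-Complex.I))).const_mul (1 / 2)).congr
    (fun x => by simp only [_root_.cd]; ring) fun k => by simp [phase_apply]; ring

lemma Represents.cdbar {c : ℝ} {f : E3 → ℂ} {w : E2 → ℂ} (h : Represents c f w) :
    Represents c (cdbar f) (fun k => (Complex.I / 2 * (k 0 + k 1 * Complex.I)) * w k) :=
  (((h.pd 0).add ((h.pd 1).const_mul Complex.I)).const_mul (1 / 2)).congr
    (fun x => by simp only [_root_.cdbar]) fun k => by simp [phase_apply]; ring

lemma represents_coul (c : ℝ) :
    Represents c (coul (mk3 0 0 c)) (fun k => 1 / (2 * π) * (‖k‖ : ℂ)⁻¹) := by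
  refine Represents.congr (f := fun x => 1 / (2 * π) * (2 * π * coul (mk3 0 0 c) x))
    (Represents.const_mul (w := fun k : E2 => (‖k‖ : ℂ)⁻¹) ⟨⟨?_, fun δ hδ => ?_⟩, fun x hx => ?_⟩ _)
    (fun x => ?_) fun k => rfl
  · exact Measurable.aestronglyMeasurable (by fun_prop)
  · simpa using integrable_exp_neg_mul_norm_mul_inv_norm hδ
  · have h := integral_exp_mul_inv_norm (x 0) (x 1) (c - x 2) (sub_pos.2 hx)
    have hn : ‖x - mk3 0 0 c‖ = √(x 0 ^ 2 + x 1 ^ 2 + (c - x 2) ^ 2) := by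
      rw [EuclideanSpace.norm_eq, Fin.sum_univ_three]
      simp [mk3]
      congr 1; ring
    simp only [coul]
    rw [hn, ← div_eq_mul_inv, ← h, fourierLaplace]
    refine integral_congr_ae (ae_of_all _ fun k => ?_)
    simp only [phase_apply]
    congr 2
    push_cast; ring
  · have : (π : ℂ) ≠ 0 := by exact_mod_cast pi_ne_zero
    field_simp

/-- The Fourier weight of the `2^M`-pole field. -/
def poleWeight (M : ℕ) (A : ℤ → ℂ) (k : E2) : ℂ :=
  ∑ m ∈ Finset.Icc (-(M : ℤ)) (M : ℤ), A m *
    (if 1 ≤ m then (‖k‖ : ℂ) ^ ((M : ℤ) - m).toNat *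
        ((Complex.I / 2 * (k 0 + k 1 * Complex.I)) ^ m.toNat * (1 / (2 * π) * (‖k‖ : ℂ)⁻¹))
      else (‖k‖ : ℂ) ^ ((M : ℤ) + m).toNat *
        ((Complex.I / 2 * (k 0 - k 1 * Complex.I)) ^ (-m).toNat * (1 / (2 * π) * (‖k‖ : ℂ)⁻¹)))

lemma represents_pole (M : ℕ) (A : ℤ → ℂ) (c : ℝ) :
    Represents c (pole M A (mk3 0 0 c)) (poleWeight M A) := by
  refine Represents.sum _ fun m _ => Represents.const_mul ?_ _
  split_ifs with hm
  · exact ((represents_coul c).iterate (fun _ _ h => h.cdbar) _).iterate (fun _ _ h => h.pd_two) _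
  · exact ((represents_coul c).iterate (fun _ _ h => h.cd) _).iterate (fun _ _ h => h.pd_two) _

lemma norm_mul_exp_polarAngle (k : E2) :
    (k 0 : ℂ) + k 1 * Complex.I = ‖k‖ * Complex.exp (polarAngle k * Complex.I) := by
  have hn : ‖(k 0 : ℂ) + k 1 * Complex.I‖ = ‖k‖ := by
    rw [Complex.norm_add_mul_I, EuclideanSpace.norm_eq, Fin.sum_univ_two]
    simp
  have h := Complex.norm_mul_exp_arg_mul_I ((k 0 : ℂ) + k 1 * Complex.I)
  rw [hn] at h
  conv_lhs => rw [← h]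
  congr 1
  unfold polarAngle
  split_ifs
  · push_cast
    rw [add_mul, Complex.exp_add, Complex.exp_two_pi_mul_I, mul_one]
  · rfl

lemma norm_mul_exp_neg_polarAngle (k : E2) :
    (k 0 : ℂ) - k 1 * Complex.I = ‖k‖ * Complex.exp (-(polarAngle k * Complex.I)) := by
  have h := congrArg (starRingEnd ℂ) (norm_mul_exp_polarAngle k)
  simp only [map_add, map_mul, Complex.conj_ofReal, Complex.conj_I, ← Complex.exp_conj] at h
  rw [mul_neg, mul_neg] at h
  rw [← h]; ring

lemma poleWeight_eq (M : ℕ) (A : ℤ → ℂ) {k : E2} (hk : k ≠ 0) :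
    poleWeight M A k
      = 1 / (2 * π) * ((‖k‖ : ℂ) ^ ((M : ℤ) - 1) * Theta M A (polarAngle k)) := by
  have hk0 : (‖k‖ : ℂ) ≠ 0 := by exact_mod_cast (norm_pos_iff.2 hk).ne'
  rw [poleWeight, Theta, mul_sum, mul_sum]
  refine sum_congr rfl fun m hm => ?_
  rw [Finset.mem_Icc] at hm
  rw [zpow_sub_one₀ hk0, zpow_natCast]
  split_ifs with h1
  · obtain ⟨n, rfl⟩ := Int.eq_ofNat_of_zero_le (by lia : 0 ≤ m)
    have hM : (‖k‖ : ℂ) ^ M = (‖k‖ : ℂ) ^ ((M : ℤ) - n).toNat * (‖k‖ : ℂ) ^ n := by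
      rw [← pow_add]; congr 1; lia
    have he : Complex.exp (Complex.I * ((n : ℤ) : ℂ) * polarAngle k)
        = Complex.exp (polarAngle k * Complex.I) ^ n := by
      rw [← Complex.exp_nat_mul]; congr 1; push_cast; ring
    rw [hM, he, norm_mul_exp_polarAngle, Int.toNat_natCast, Int.natAbs_natCast]
    ring
  · obtain ⟨n, hn⟩ := Int.eq_ofNat_of_zero_le (by lia : 0 ≤ -m)
    obtain rfl : m = -(n : ℤ) := by lia
    have hM : (‖k‖ : ℂ) ^ M = (‖k‖ : ℂ) ^ ((M : ℤ) + -(n : ℤ)).toNat * (‖k‖ : ℂ) ^ n := by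
      rw [← pow_add]; congr 1; lia
    have he : Complex.exp (Complex.I * ((-(n : ℤ) : ℤ) : ℂ) * polarAngle k)
        = Complex.exp (-(polarAngle k * Complex.I)) ^ n := by
      rw [← Complex.exp_nat_mul]; congr 1; push_cast; ring
    rw [hM, he, norm_mul_exp_neg_polarAngle, neg_neg, Int.toNat_natCast, Int.natAbs_neg,
      Int.natAbs_natCast]
    ring

/-- Two-dimensional Fourier representation of a `2^M`-pole field centred at
`X₊ = (0,0,R/2)`: for `x₃ < R/2`,
`f_M(x) = (1/2π) ∫_{ℝ²} e^{-‖k‖(R/2-x₃)} ‖k‖^{M-1} Θ(ψ(k)) e^{i(k₁x₁+k₂x₂)} dk`. -/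
theorem multipole_fourier_representation
    (M : ℕ) (R : ℝ) (hR : 0 < R) (A : ℤ → ℂ)
    (x₁ x₂ x₃ : ℝ) (hx : x₃ < R / 2) :
    Integrable (fun k : E2 =>
      ((Real.exp (-(‖k‖ * (R / 2 - x₃))) : ℝ) : ℂ) * (‖k‖ : ℂ) ^ ((M : ℤ) - 1) *
        Theta M A (polarAngle k) *
          Complex.exp (Complex.I * ((k 0 * x₁ + k 1 * x₂ : ℝ) : ℂ))) ∧
    pole M A (mk3 0 0 (R / 2)) (mk3 x₁ x₂ x₃)
      = (1 / (2 * (π : ℂ))) * ∫ k : E2,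
          ((Real.exp (-(‖k‖ * (R / 2 - x₃))) : ℝ) : ℂ) * (‖k‖ : ℂ) ^ ((M : ℤ) - 1) *
            Theta M A (polarAngle k) *
              Complex.exp (Complex.I * ((k 0 * x₁ + k 1 * x₂ : ℝ) : ℂ)) := by
  obtain ⟨hadm, heq⟩ := represents_pole M A (R / 2)
  have hx2 : (mk3 x₁ x₂ x₃) 2 < R / 2 := by simpa [mk3] using hx
  have hpi : (π : ℂ) ≠ 0 := by exact_mod_cast pi_ne_zero
  have hae : (fun k : E2 => (2 * π : ℂ) *
      (Complex.exp (phase k (mk3 x₁ x₂ x₃) - ‖k‖ * (R / 2 : ℝ)) * poleWeight M A k)) =ᵐ[volume] fun k : E2 =>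
      ((Real.exp (-(‖k‖ * (R / 2 - x₃))) : ℝ) : ℂ) * (‖k‖ : ℂ) ^ ((M : ℤ) - 1) *
        Theta M A (polarAngle k) *
          Complex.exp (Complex.I * ((k 0 * x₁ + k 1 * x₂ : ℝ) : ℂ)) := by
    filter_upwards [Measure.ae_ne volume (0 : E2)] with k hk
    have hexp : Complex.exp (phase k (mk3 x₁ x₂ x₃) - ‖k‖ * (R / 2 : ℝ))
        = ((Real.exp (-(‖k‖ * (R / 2 - x₃))) : ℝ) : ℂ) *
          Complex.exp (Complex.I * ((k 0 * x₁ + k 1 * x₂ : ℝ) : ℂ)) := by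
      rw [Complex.ofReal_exp, ← Complex.exp_add, phase_apply]
      congr 1
      simp [mk3]
      ring
    rw [hexp, poleWeight_eq M A hk]
    field_simp
  refine ⟨((hadm.integrable hx2).const_mul _).congr hae, ?_⟩
  rw [← integral_congr_ae hae, integral_const_mul, heq _ hx2, fourierLaplace]
  rw [← mul_assoc, one_div_mul_cancel (mul_ne_zero two_ne_zero hpi), one_mul]
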